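/- arXiv:0811.3186 — 4 statements merged into one kernel-verified Lean document; each statement's English description precedes it below -/
import Mathlib

section
/- Let V be a finite-dimensional vector space over F = ℂ((t)) with a connection ∇, and let L ⊂ V be a lattice. Then the relative dimension of ∇⁻¹(L) = {v ∈ V : ∇v ∈ L} with respect to L is nonpositive: dim_ℂ( ∇⁻¹(L) / (∇⁻¹(L) ∩ L) ) ≤ dim_ℂ( L / (∇⁻¹(L) ∩ L) ). -/
open HahnSeries Matrix

noncomputable section

/-- The formal derivative `∂ₜ` on the field `F = ℂ((t))` of formal Laurent series:
`∂ₜ (Σₙ aₙ tⁿ) = Σₙ n aₙ tⁿ⁻¹`. -/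
def dt (f : LaurentSeries ℂ) : LaurentSeries ℂ where
  coeff := fun k => (k + 1 : ℤ) * f.coeff (k + 1)
  isPWO_support' := by
    apply Set.IsPWO.mono (f.isPWO_support'.image_of_monotone
      (f := fun k : ℤ => k - 1) (fun a b h => by simp only []; omega))
    intro k hk
    simp only [Function.mem_support, ne_eq] at hk
    refine ⟨k + 1, ?_, by ring⟩
    simp only [Function.mem_support, ne_eq]
    intro h
    exact hk (by rw [h, mul_zero])

/-- An `O`-lattice in an `F`-vector space `V` (`O = ℂ[[t]]`, `F = ℂ((t))`): a finitely
generated `O`-submodule which spans `V` over `F`. -/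
def IsOLattice {V : Type} [AddCommGroup V] [Module (PowerSeries ℂ) V]
    [Module (LaurentSeries ℂ) V] (M : Submodule (PowerSeries ℂ) V) : Prop :=
  M.FG ∧ Submodule.span (LaurentSeries ℂ) (M : Set V) = ⊤

/-- Two `ℂ`-subspaces `L, L'` of `V` are commensurable if `L/(L ∩ L')` and `L'/(L ∩ L')`
are finite-dimensional over `ℂ`. -/
def AreCommensurable {V : Type} [AddCommGroup V] [Module ℂ V]
    (L L' : Submodule ℂ V) : Prop :=
  FiniteDimensional ℂ (↥L ⧸ Submodule.comap L.subtype (L ⊓ L')) ∧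
  FiniteDimensional ℂ (↥L' ⧸ Submodule.comap L'.subtype (L ⊓ L'))

/-- A lattice in `V`: a `ℂ`-subspace commensurable with some `O`-lattice. -/
def IsLatticeIn {V : Type} [AddCommGroup V] [Module ℂ V] [Module (PowerSeries ℂ) V]
    [Module (LaurentSeries ℂ) V] [IsScalarTower ℂ (PowerSeries ℂ) V]
    (L : Submodule ℂ V) : Prop :=
  ∃ M : Submodule (PowerSeries ℂ) V, IsOLattice M ∧
    AreCommensurable L (M.restrictScalars ℂ)

section RelLength

variable {k : Type*} [Field k] {W W' : Type*} [AddCommGroup W] [Module k W]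
  [AddCommGroup W'] [Module k W']

/-- The dimension of `Q / (P ∩ Q)`, as an extended natural number. -/
def relLength (P Q : Submodule k W) : ℕ∞ := Module.length k (Q.map P.mkQ)

lemma length_eq_length_inf_ker_add_length_map (g : W →ₗ[k] W') (Q : Submodule k W) :
    Module.length k Q =
      Module.length k ↥(Q ⊓ LinearMap.ker g) + Module.length k (Q.map g) := by
  refine Module.length_eq_add_of_exact (Submodule.inclusion inf_le_left)
    (g.submoduleMap Q) (Submodule.inclusion_injective _) (g.submoduleMap_surjective Q) ?_
  intro x
  constructor
  · intro h
    exact ⟨⟨x, x.2, by simpa using congrArg Subtype.val h⟩, rfl⟩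
  · rintro ⟨y, rfl⟩
    exact Subtype.ext (by simpa using y.2.2)

lemma length_map_of_injective {g : W →ₗ[k] W'} (hg : Function.Injective g) (Q : Submodule k W) :
    Module.length k (Q.map g) = Module.length k Q :=
  (Submodule.equivMapOfInjective g hg Q).length_eq.symm

lemma length_submodule_mono {P Q : Submodule k W} (h : P ≤ Q) :
    Module.length k P ≤ Module.length k Q :=
  Module.length_le_of_injective _ (Submodule.inclusion_injective h)

lemma relLength_eq_length_quotient (P Q : Submodule k W) :
    relLength P Q = Module.length k (Q ⧸ P.comap Q.subtype) := by
  have e := (P.mkQ ∘ₗ Q.subtype).quotKerEquivRange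
  have hk : LinearMap.ker (P.mkQ ∘ₗ Q.subtype) = P.comap Q.subtype := by
    rw [LinearMap.ker_comp, Submodule.ker_mkQ]
  have hr : LinearMap.range (P.mkQ ∘ₗ Q.subtype) = Q.map P.mkQ := by
    rw [LinearMap.range_comp, Submodule.range_subtype]
  rw [hk, hr] at e
  exact e.length_eq.symm

lemma relLength_inf_left (P Q : Submodule k W) : relLength (P ⊓ Q) Q = relLength P Q := by
  have : (P ⊓ Q).comap Q.subtype = P.comap Q.subtype := by ext x; simp
  rw [relLength_eq_length_quotient, relLength_eq_length_quotient, this]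

lemma relLength_sup_right (P Q : Submodule k W) : relLength P (P ⊔ Q) = relLength P Q := by
  have : (P ⊔ Q).map P.mkQ = Q.map P.mkQ := by
    rw [Submodule.map_sup, Submodule.mkQ_map_self, bot_sup_eq]
  rw [relLength, relLength, this]

lemma relLength_mono {P Q R : Submodule k W} (h : Q ≤ R) : relLength P Q ≤ relLength P R :=
  length_submodule_mono (Submodule.map_mono h)

lemma relLength_eq_zero {P Q : Submodule k W} : relLength P Q = 0 ↔ Q ≤ P := by
  rw [relLength, Module.length_eq_zero_iff, Submodule.subsingleton_iff_eq_bot,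
    ← LinearMap.le_ker_iff_map, Submodule.ker_mkQ]

lemma relLength_add {P Q R : Submodule k W} (hPQ : P ≤ Q) (hQR : Q ≤ R) :
    relLength P R = relLength P Q + relLength Q R := by
  have h := length_eq_length_inf_ker_add_length_map (Submodule.factor hPQ) (R.map P.mkQ)
  have hk : LinearMap.ker (Submodule.factor hPQ) = Q.map P.mkQ := by
    rw [Submodule.factor, Submodule.ker_mapQ, Submodule.comap_id]
  rw [hk, inf_eq_right.2 (Submodule.map_mono hQR), ← Submodule.map_comp,
    Submodule.factor_comp_mk] at h
  exact h

lemma relLength_anti {P Q R : Submodule k W} (h : P ≤ Q) : relLength Q R ≤ relLength P R := by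
  rw [← relLength_inf_left P R, ← relLength_inf_left Q R,
    relLength_add (inf_le_inf_right R h) inf_le_right]
  exact le_add_self

lemma relLength_comap (g : W →ₗ[k] W') (P : Submodule k W') (Q : Submodule k W) :
    relLength (P.comap g) Q = relLength P (Q.map g) := by
  have hinj : Function.Injective (Submodule.mapQ (P.comap g) P g le_rfl) := by
    rw [← LinearMap.ker_eq_bot, Submodule.ker_mapQ, Submodule.mkQ_map_self]
  rw [relLength, ← length_map_of_injective hinj, ← Submodule.map_comp, Submodule.mapQ_mkQ,
    Submodule.map_comp, relLength]

lemma relLength_bot_sup {P Q : Submodule k W} (h : Disjoint P Q) :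
    relLength ⊥ (P ⊔ Q) = relLength ⊥ P + relLength ⊥ Q := by
  rw [relLength_add bot_le (le_sup_left : P ≤ P ⊔ Q), relLength_sup_right,
    ← relLength_inf_left P Q, h.eq_bot]

lemma card_mul_le_relLength_of_supIndep {α : Type*} (S : Finset α) (T : α → Submodule k W)
    (hT : S.SupIndep T) {U : Submodule k W} (hU : ∀ s ∈ S, T s ≤ U) {c : ℕ∞}
    (hc : ∀ s ∈ S, c ≤ relLength ⊥ (T s)) : S.card * c ≤ relLength ⊥ U := by
  classical
  refine le_trans ?_ (relLength_mono (Finset.sup_le hU))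
  clear hU
  induction S using Finset.induction_on with
  | empty => simp
  | insert a S ha ih =>
    have h := ih (hT.subset (Finset.subset_insert _ _))
      (fun s hs => hc s (Finset.mem_insert_of_mem hs))
    have hd : Disjoint (T a) (S.sup T) :=
      hT (Finset.subset_insert _ _) (Finset.mem_insert_self _ _) ha
    rw [Finset.sup_insert, relLength_bot_sup hd, Finset.card_insert_of_notMem ha,
      Nat.cast_add, Nat.cast_one, add_mul, one_mul, add_comm]
    exact add_le_add (hc a (Finset.mem_insert_self _ _)) h

/-- Approximate eigenspaces of `θ` for distinct eigenvalues, where `θ v = s • v` is only required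
modulo `N`, are independent up to a subspace of dimension `dim (N / P)` in each of them. -/
lemma card_mul_le_relLength_of_approx_eigenspace (θ : W →ₗ[k] W) {P N U : Submodule k W}
    (hfin : relLength P N ≠ ⊤) {α : Type*} (S : Finset α) (e : α → k)
    (he : Function.Injective e) (T : α → Submodule k W)
    (hPT : ∀ s ∈ S, P ≤ T s) (hTU : ∀ s ∈ S, T s ≤ U)
    (hθ : ∀ s ∈ S, ∀ v ∈ T s, θ v - e s • v ∈ N) {c : ℕ∞}
    (hc : ∀ s ∈ S, relLength P N + c ≤ relLength P (T s)) :
    S.card * c ≤ relLength N U := by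
  obtain ⟨C, hC⟩ := Submodule.exists_isCompl N
  let q : W →ₗ[k] C := Submodule.projectionOnto C N hC.symm
  have hq : ∀ x : C, q x = x := fun x => Submodule.projectionOnto_apply_left hC.symm x
  have hqN : ∀ x ∈ N, q x = 0 := fun x hx => by
    exact (Submodule.projectionOnto_apply_eq_zero_iff hC.symm).2 hx
  let E : Module.End k C := q ∘ₗ θ ∘ₗ C.subtype
  have hdisj : ∀ X : Submodule k W, relLength ⊥ (X.comap C.subtype) ≤ relLength N X := by
    intro X
    have h1 : (⊥ : Submodule k C) = N.comap C.subtype := by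
      refine (Submodule.eq_bot_iff _).2 ?_ |>.symm
      intro x hx
      exact Subtype.ext (Submodule.disjoint_def.1 hC.disjoint x hx x.2)
    rw [h1, relLength_comap]
    exact relLength_mono (Submodule.map_comap_le _ _)
  refine le_trans (card_mul_le_relLength_of_supIndep S (fun s => (T s).comap C.subtype) ?_
    (U := U.comap C.subtype) (fun s hs => Submodule.comap_mono (hTU s hs)) ?_) (hdisj U)
  · refine Finset.SupIndep.antitone_fun ?_
      (((Module.End.eigenspaces_iSupIndep E).comp he).supIndep' S)
    intro s hs x hx
    rw [Function.comp_apply, Module.End.mem_eigenspace_iff]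
    have := hqN _ (hθ s hs x hx)
    rw [map_sub, map_smul, hq, sub_eq_zero] at this
    exact this
  · intro s hs
    have h1 : relLength P (T s) = relLength P (T s ⊓ (P ⊔ C)) + relLength (P ⊔ C) (T s) := by
      rw [relLength_add (Q := T s ⊓ (P ⊔ C)) (le_inf (hPT s hs) le_sup_left) inf_le_left,
        inf_comm, relLength_inf_left]
    have h2 : relLength (P ⊔ C) (T s) ≤ relLength P N := by
      calc relLength (P ⊔ C) (T s) ≤ relLength (P ⊔ C) (P ⊔ C ⊔ N) := relLength_mono (by
            rw [sup_assoc, sup_comm C N, hC.sup_eq_top]; simp)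
        _ = relLength (P ⊔ C) N := relLength_sup_right _ _
        _ ≤ relLength P N := relLength_anti le_sup_left
    have h3 : relLength P (T s ⊓ (P ⊔ C)) ≤ relLength ⊥ ((T s).comap C.subtype) := by
      have : T s ⊓ (P ⊔ C) = P ⊔ (T s ⊓ C) := by
        rw [inf_comm, sup_inf_assoc_of_le _ (hPT s hs), inf_comm]
      rw [this, relLength_sup_right]
      refine (relLength_anti bot_le).trans ?_
      have h : T s ⊓ C = ((T s).comap C.subtype).map C.subtype := by
        rw [Submodule.map_comap_subtype, inf_comm]
      rw [h, ← relLength_comap]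
      simp
    have h4 := hc s hs
    rw [h1] at h4
    have h5 := h4.trans (add_le_add h3 h2)
    rw [add_comm] at h5
    exact (ENat.add_le_add_iff_right hfin).1 h5

lemma exists_forall_eq_of_monotone_of_le {f : ℕ → ℕ∞} (hf : Monotone f) {c : ℕ∞} (hc : c ≠ ⊤)
    (h : ∀ m, f m ≤ c) : ∃ a, ∀ m, a ≤ m → f m = f a := by
  lift c to ℕ using hc
  have hfin : (Set.range f).Finite := by
    refine ((Set.finite_Iic c).image (Nat.cast : ℕ → ℕ∞)).subset ?_
    rintro _ ⟨m, rfl⟩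
    have hm := h m
    lift f m to ℕ using ne_top_of_le_ne_top (ENat.natCast_ne_top c) hm with d
    exact ⟨d, by exact_mod_cast hm, rfl⟩
  obtain ⟨_, ⟨a, rfl⟩, ha⟩ := Set.exists_max_image _ id hfin (Set.range_nonempty f)
  exact ⟨a, fun m hm => le_antisymm (ha _ ⟨m, rfl⟩) (hf hm)⟩

lemma exists_forall_le_sup_of_monotone {P : Submodule k W} {A : ℕ → Submodule k W}
    (hA : Monotone A) {c : ℕ∞} (hc : c ≠ ⊤) (h : ∀ m, relLength P (A m) ≤ c) :
    ∃ a, ∀ m, A m ≤ P ⊔ A a := by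
  obtain ⟨a, ha⟩ := exists_forall_eq_of_monotone_of_le
    (fun i j hij => relLength_mono (P := P) (hA hij)) hc h
  refine ⟨a, fun m v hm => ?_⟩
  have h1 := ha (max a m) (le_max_left _ _)
  rw [← relLength_sup_right, ← relLength_sup_right P (A a),
    relLength_add le_sup_left (sup_le_sup_left (hA (le_max_left a m)) P)] at h1
  have h2 : relLength (P ⊔ A a) (P ⊔ A (max a m)) = 0 := by
    refine ENat.add_right_injective_of_ne_top (ne_top_of_le_ne_top hc (h a)) ?_
    simpa [relLength_sup_right P (A a)] using h1
  exact relLength_eq_zero.1 h2 ((le_sup_right : A _ ≤ _) (hA (le_max_right a m) hm))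

/-- An increasing union of subspaces has relative dimension at most `c` as soon as each of
them does. -/
lemma relLength_le_of_monotone {P Q : Submodule k W} {A : ℕ → Submodule k W} (hA : Monotone A)
    (hQ : ∀ v ∈ Q, ∃ m, v ∈ A m) {c : ℕ∞} (hc : c ≠ ⊤) (h : ∀ m, relLength P (A m) ≤ c) :
    relLength P Q ≤ c := by
  obtain ⟨a, ha⟩ := exists_forall_le_sup_of_monotone hA hc h
  refine le_trans ?_ (h a)
  rw [← relLength_sup_right P (A a)]
  refine relLength_mono fun v hv => ?_
  obtain ⟨m, hm⟩ := hQ v hv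
  exact ha m hm

lemma relLength_le_of_antitone {P Q : Submodule k W} {E : ℕ → Submodule k W} (hE : Antitone E)
    (hEQ : ∀ m, E m ≤ Q) (hP : ∀ v, (∀ m, v ∈ E m) → v ∈ P) {c : ℕ∞}
    (hc : c ≠ ⊤) (h : ∀ m, relLength (E m) Q ≤ c) : relLength P Q ≤ c := by
  obtain ⟨a, ha⟩ := exists_forall_eq_of_monotone_of_le
    (fun i j hij => relLength_anti (R := Q) (hE hij)) hc h
  refine (relLength_anti fun v hv => hP v fun m => ?_).trans (h a)
  have h1 := ha (max a m) (le_max_left _ _)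
  rw [relLength_add (hE (le_max_left a m)) (hEQ a)] at h1
  have h2 : relLength (E (max a m)) (E a) = 0 := by
    refine ENat.add_left_injective_of_ne_top (ne_top_of_le_ne_top hc (h a)) ?_
    simpa using h1
  exact hE (le_max_right a m) (relLength_eq_zero.1 h2 hv)

/-- If every functional on a space `X` of functionals on `W` is an evaluation, a system of linear
equations `g b w = y b` with all `g b` in `X` is solvable once its finite subsystems are. -/
lemma exists_forall_eq_of_finite {X : Submodule k (Module.Dual k W)}
    (hX : ∀ ξ : Module.Dual k (Module.Dual k W), ∃ w, ∀ φ ∈ X, ξ φ = φ w)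
    {β : Type*} (g : β → Module.Dual k W) (hg : ∀ b, g b ∈ X) (y : β → k)
    (h : ∀ s : Finset β, ∃ w, ∀ b ∈ s, g b w = y b) : ∃ w, ∀ b, g b w = y b := by
  let f := Finsupp.linearCombination k g
  let Y := Finsupp.linearCombination k y
  have hY : Y ∈ (LinearMap.ker f).dualAnnihilator := by
    rw [Submodule.mem_dualAnnihilator]
    intro a ha
    obtain ⟨w, hw⟩ := h a.support
    have h1 : f a w = 0 := by rw [LinearMap.mem_ker.1 ha]; rfl
    rw [← h1]
    simp only [f, Y, Finsupp.linearCombination_apply, Finsupp.sum, LinearMap.sum_apply,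
      LinearMap.smul_apply]
    exact Finset.sum_congr rfl fun b hb => by rw [hw b hb]
  rw [← LinearMap.range_dualMap_eq_dualAnnihilator_ker] at hY
  obtain ⟨ξ, hξ⟩ := hY
  obtain ⟨w, hw⟩ := hX ξ
  refine ⟨w, fun b => ?_⟩
  rw [← hw _ (hg b)]
  have := LinearMap.congr_fun hξ (Finsupp.single b 1)
  simpa [f, Y] using this

end RelLength

section StdLattice

lemma exists_coeff_eq_zero_of_lt (f : LaurentSeries ℂ) : ∃ N : ℕ, ∀ l < -(N : ℤ), f.coeff l = 0 :=
  ⟨f.order.natAbs, fun _ hl => HahnSeries.coeff_eq_zero_of_lt_order (by omega)⟩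

lemma coeff_mul_eq_zero_of_lt {f g : LaurentSeries ℂ} {a b : ℤ} (hf : ∀ l < a, f.coeff l = 0)
    (hg : ∀ l < b, g.coeff l = 0) : ∀ l < a + b, (f * g).coeff l = 0 := by
  intro l hl
  rw [HahnSeries.coeff_mul]
  refine Finset.sum_eq_zero fun ij hij => ?_
  obtain ⟨-, -, h⟩ := Finset.mem_antidiagonal.1 hij
  by_cases h1 : ij.1 < a
  · rw [hf _ h1, zero_mul]
  · rw [hg _ (by omega), mul_zero]

lemma exists_coe_eq_of_coeff_eq_zero {f : LaurentSeries ℂ} (hf : ∀ l < 0, f.coeff l = 0) :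
    ∃ g : PowerSeries ℂ, (g : LaurentSeries ℂ) = f :=
  (LaurentSeries.val_le_one_iff_eq_coe ℂ f).1 <|
    (LaurentSeries.valuation_le_iff_coeff_lt_eq_zero ℂ (D := 0) (f := f)).2 (by simpa using hf)

lemma dt_single (m : ℤ) :
    dt (HahnSeries.single m 1) = HahnSeries.single (m - 1) (m : ℂ) := by
  ext l
  by_cases h : l = m - 1
  · subst h; simp [dt]
  · have : l + 1 ≠ m := by omega
    simp [dt, HahnSeries.coeff_single_of_ne, h, this]

variable {V : Type*} [AddCommGroup V] [Module ℂ V] [Module (LaurentSeries ℂ) V]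
  [IsScalarTower ℂ (LaurentSeries ℂ) V]
  {ι : Type*} (b : Module.Basis ι (LaurentSeries ℂ) V)

/-- The coefficient of `tᵐ` in the `i`-th coordinate with respect to a basis. -/
def coordCoeff (i : ι) (m : ℤ) : V →ₗ[ℂ] ℂ where
  toFun v := (b.repr v i).coeff m
  map_add' := by simp
  map_smul' c v := by
    have : c • v = (HahnSeries.single 0 c : LaurentSeries ℂ) • v := by
      rw [← mul_one (HahnSeries.single 0 c), HahnSeries.single_zero_mul_eq_smul, smul_assoc,
        one_smul]
    rw [this, map_smul, Finsupp.smul_apply, smul_eq_mul, HahnSeries.coeff_single_zero_mul]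
    rfl

/-- The lattice of vectors all of whose coordinates are divisible by `tᵐ`. -/
def stdLattice (m : ℤ) : Submodule ℂ V where
  carrier := {v | ∀ i, ∀ l < m, coordCoeff b i l v = 0}
  add_mem' hv hw i l hl := by rw [map_add, hv i l hl, hw i l hl, add_zero]
  zero_mem' i l _ := map_zero _
  smul_mem' c v hv i l hl := by rw [map_smul, hv i l hl, smul_zero]

lemma mem_stdLattice {m : ℤ} {v : V} :
    v ∈ stdLattice b m ↔ ∀ i, ∀ l < m, coordCoeff b i l v = 0 := Iff.rfl

lemma stdLattice_anti {j m : ℤ} (h : j ≤ m) : stdLattice b m ≤ stdLattice b j :=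
  fun _ hv i l hl => hv i l (hl.trans_le h)

lemma smul_mem_stdLattice {f : LaurentSeries ℂ} {a j : ℤ} (hf : ∀ l < a, f.coeff l = 0) {v : V}
    (hv : v ∈ stdLattice b j) : f • v ∈ stdLattice b (a + j) := by
  intro i l hl
  have : b.repr (f • v) i = f * b.repr v i := by simp
  change (b.repr (f • v) i).coeff l = 0
  rw [this]
  exact coeff_mul_eq_zero_of_lt hf (hv i) l hl

lemma single_smul_mem_stdLattice {m j : ℤ} (c : ℂ) {v : V} (hv : v ∈ stdLattice b j) :
    (HahnSeries.single m c : LaurentSeries ℂ) • v ∈ stdLattice b (m + j) :=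
  smul_mem_stdLattice b (fun _ hl => HahnSeries.coeff_single_of_ne hl.ne) hv

lemma eq_of_forall_coordCoeff_eq {v w : V} (h : ∀ i l, coordCoeff b i l v = coordCoeff b i l w) :
    v = w :=
  b.repr.injective <| Finsupp.ext fun i => HahnSeries.ext <| funext fun l => h i l

variable [Fintype ι]

lemma exists_coordCoeff_eq (c : ι → ℤ → ℂ) (j : ℤ) :
    ∃ v ∈ stdLattice b j, ∀ i, ∀ l ≥ j, coordCoeff b i l v = c i l := by
  have hb : ∀ i, BddBelow (Function.support fun l => if l < j then 0 else c i l) := by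
    refine fun i => ⟨j, fun l hl => ?_⟩
    by_contra h
    exact hl (if_pos (not_le.1 h))
  let a : ι → LaurentSeries ℂ := fun i => HahnSeries.ofSuppBddBelow _ (hb i)
  have ha : ∀ i l, coordCoeff b i l (b.equivFun.symm a) = if l < j then 0 else c i l := by
    intro i l
    change (b.equivFun (b.equivFun.symm a) i).coeff l = _
    rw [LinearEquiv.apply_symm_apply]
    rfl
  exact ⟨b.equivFun.symm a, fun i l hl => by rw [ha, if_pos hl],
    fun i l hl => by rw [ha, if_neg (not_lt.2 hl)]⟩

lemma exists_mem_stdLattice (v : V) : ∃ N : ℕ, v ∈ stdLattice b (-(N : ℤ)) := by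
  choose N hN using fun i => exists_coeff_eq_zero_of_lt (b.repr v i)
  refine ⟨Finset.univ.sup N, fun i l hl => hN i l ?_⟩
  have : N i ≤ Finset.univ.sup N := Finset.le_sup (Finset.mem_univ i)
  omega

lemma relLength_stdLattice_succ (m : ℤ) :
    relLength (stdLattice b (m + 1)) (stdLattice b m) = Fintype.card ι := by
  let g : V →ₗ[ℂ] ι → ℂ := LinearMap.pi fun i => coordCoeff b i m
  have h1 : stdLattice b (m + 1) = (⊥ : Submodule ℂ (ι → ℂ)).comap g ⊓ stdLattice b m := by
    ext v
    simp only [Submodule.mem_inf, Submodule.mem_comap, Submodule.mem_bot, mem_stdLattice]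
    constructor
    · exact fun h => ⟨funext fun i => h i m (by omega), fun i l hl => h i l (by omega)⟩
    · rintro ⟨h, h'⟩ i l hl
      rcases (show l ≤ m by omega).lt_or_eq with hl | rfl
      · exact h' i l hl
      · exact congrFun h i
  have h2 : (stdLattice b m).map g = ⊤ := by
    refine eq_top_iff.2 fun c _ => ?_
    obtain ⟨v, hv, h⟩ := exists_coordCoeff_eq b (fun i _ => c i) m
    exact ⟨v, hv, funext fun i => h i m le_rfl⟩
  rw [h1, relLength_inf_left, relLength_comap, h2, relLength_eq_length_quotient]
  have h3 : (⊥ : Submodule ℂ (ι → ℂ)).comap (⊤ : Submodule ℂ (ι → ℂ)).subtype = ⊥ := by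
    ext x; simp
  rw [h3, (Submodule.quotEquivOfEqBot _ rfl).length_eq, Module.length_top,
    Module.length_eq_finrank, Module.finrank_fintype_fun_eq_card]

lemma relLength_stdLattice {j m : ℤ} (d : ℕ) (h : m = j + d) :
    relLength (stdLattice b m) (stdLattice b j) = (Fintype.card ι * d : ℕ) := by
  induction d generalizing m with
  | zero =>
    obtain rfl : m = j := by simpa using h
    simpa using relLength_eq_zero.2 le_rfl
  | succ d ih =>
    have hm : m = j + d + 1 := by push_cast at h; omega
    rw [hm, relLength_add (stdLattice_anti b (by omega : j + d ≤ j + d + 1))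
      (stdLattice_anti b (by omega : j ≤ j + d)), relLength_stdLattice_succ, ih rfl]
    push_cast
    ring

end StdLattice

section Connection

variable {V : Type*} [AddCommGroup V] [Module ℂ V] [Module (LaurentSeries ℂ) V]
  [IsScalarTower ℂ (LaurentSeries ℂ) V]
  {ι : Type*} [Fintype ι] (b : Module.Basis ι (LaurentSeries ℂ) V) {nabla : V →ₗ[ℂ] V}
  (hleib : ∀ (f : LaurentSeries ℂ) (v : V), nabla (f • v) = dt f • v + f • nabla v)

include hleib in
lemma exists_nabla_mem_stdLattice :
    ∃ r : ℕ, ∀ j, ∀ v ∈ stdLattice b j, nabla v ∈ stdLattice b (j - (r + 1)) := by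
  choose N hN using fun i => exists_mem_stdLattice b (nabla (b i))
  refine ⟨Finset.univ.sup N, fun j v hv => ?_⟩
  rw [← b.sum_repr v, map_sum]
  refine Submodule.sum_mem _ fun i _ => ?_
  rw [hleib]
  have hN' : N i ≤ Finset.univ.sup N := Finset.le_sup (Finset.mem_univ i)
  have hb : b i ∈ stdLattice b 0 := by
    classical
    intro i' l hl
    change (b.repr (b i) i').coeff l = 0
    rw [b.repr_self, Finsupp.single_apply]
    split_ifs
    · exact HahnSeries.coeff_single_of_ne hl.ne
    · rfl
  refine Submodule.add_mem _ ?_ ?_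
  · refine stdLattice_anti b (by omega) (smul_mem_stdLattice b (a := j - 1) (fun l hl => ?_) hb)
    have : (b.repr v i).coeff (l + 1) = 0 := hv i (l + 1) (by omega)
    simp [dt, this]
  · exact stdLattice_anti b (by omega) (smul_mem_stdLattice b (hv i) (hN i))

variable {r : ℕ} (hr : ∀ j, ∀ v ∈ stdLattice b j, nabla v ∈ stdLattice b (j - (r + 1)))

omit [Fintype ι] in
include hr in
lemma map_nabla_stdLattice_le (j : ℤ) :
    (stdLattice b j).map nabla ≤ stdLattice b (j - (r + 1)) := by
  rintro _ ⟨v, hv, rfl⟩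
  exact hr j v hv

include hr in
lemma relLength_comap_nabla_eq (j : ℤ) (d : ℕ) :
    relLength (stdLattice b (j + d))
        ((stdLattice b (j + d - (r + 1))).comap nabla ⊓ stdLattice b j) =
      relLength ((stdLattice b j).map nabla ⊔ stdLattice b (j + d - (r + 1)))
        (stdLattice b (j - (r + 1))) := by
  set M := stdLattice b (j + d - (r + 1))
  have h1 : relLength M (stdLattice b (j - (r + 1))) = (Fintype.card ι * d : ℕ) :=
    relLength_stdLattice b d (by ring)
  have h2 : relLength (stdLattice b (j + d)) (stdLattice b j) = (Fintype.card ι * d : ℕ) :=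
    relLength_stdLattice b d rfl
  have h3 := relLength_add (P := M) (Q := (stdLattice b j).map nabla ⊔ M) le_sup_right
    (sup_le (map_nabla_stdLattice_le b hr j) (stdLattice_anti b (by omega)))
  have h4 := relLength_add (P := stdLattice b (j + d)) (Q := M.comap nabla ⊓ stdLattice b j)
    (le_inf (hr _) (stdLattice_anti b (by omega))) inf_le_right
  rw [sup_comm, relLength_sup_right, sup_comm, h1] at h3
  have hX : relLength M ((stdLattice b j).map nabla) ≠ ⊤ := by
    refine ne_top_of_le_ne_top (ENat.natCast_ne_top (Fintype.card ι * d)) ?_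
    rw [h3]
    exact le_self_add
  rw [relLength_inf_left, relLength_comap, h2, h3, add_comm (relLength (stdLattice b (j + d)) _)]
    at h4
  exact (ENat.add_right_injective_of_ne_top hX h4).symm

/-- Multiplication by `tᵐ`. -/
def singleSMul (V : Type*) [AddCommGroup V] [Module ℂ V] [Module (LaurentSeries ℂ) V]
    [IsScalarTower ℂ (LaurentSeries ℂ) V] (m : ℤ) : V →ₗ[ℂ] V where
  toFun v := (HahnSeries.single m 1 : LaurentSeries ℂ) • v
  map_add' := smul_add _
  map_smul' c v := by
    have : ∀ w : V, c • w = (HahnSeries.single 0 c : LaurentSeries ℂ) • w := fun w => by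
      rw [← mul_one (HahnSeries.single 0 c), HahnSeries.single_zero_mul_eq_smul, smul_assoc,
        one_smul]
    rw [RingHom.id_apply, this, this, smul_smul, smul_smul, mul_comm]

lemma singleSMul_apply (m : ℤ) (v : V) :
    singleSMul V m v = (HahnSeries.single m 1 : LaurentSeries ℂ) • v := rfl

lemma singleSMul_singleSMul (m l : ℤ) (v : V) :
    singleSMul V m (singleSMul V l v) = singleSMul V (m + l) v := by
  simp [singleSMul_apply, smul_smul, HahnSeries.single_mul_single]

include hleib in
lemma nabla_singleSMul (m : ℤ) (v : V) :
    nabla (singleSMul V m v) = (m : ℂ) • singleSMul V (m - 1) v + singleSMul V m (nabla v) := by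
  have : (HahnSeries.single (m - 1) (m : ℂ) : LaurentSeries ℂ) =
      (m : ℂ) • HahnSeries.single (m - 1) (1 : ℂ) := by
    rw [← HahnSeries.single_zero_mul_eq_smul, HahnSeries.single_mul_single, zero_add, mul_one]
  rw [singleSMul_apply, hleib, dt_single, this, smul_assoc]
  rfl

include hleib hr in
lemma relLength_map_nabla_sup_le (j : ℤ) (d : ℕ) :
    relLength ((stdLattice b j).map nabla ⊔ stdLattice b (j + d - (r + 1)))
        (stdLattice b (j - (r + 1))) ≤ (Fintype.card ι * (r + 1) : ℕ) := by
  by_contra! hlt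
  set n := Fintype.card ι
  have hge : ((n * (r + 1) + 1 : ℕ) : ℕ∞) ≤
      relLength ((stdLattice b j).map nabla ⊔ stdLattice b (j + d - (r + 1)))
        (stdLattice b (j - (r + 1))) := by
    rw [Nat.cast_add, Nat.cast_one]
    exact Order.add_one_le_of_lt hlt
  let θ : V →ₗ[ℂ] V := singleSMul V 1 ∘ₗ nabla
  let T : ℕ → Submodule ℂ V := fun e =>
    (stdLattice b (-r)).comap (θ + ((j + e : ℤ) : ℂ) • LinearMap.id) ⊓ stdLattice b (-e)
  have hθ : ∀ v ∈ stdLattice b 0, θ v ∈ stdLattice b (-r) := fun v hv =>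
    stdLattice_anti b (by omega) (single_smul_mem_stdLattice b 1 (hr 0 v hv))
  let K := n * d + 1
  have hPN : relLength (stdLattice b 0) (stdLattice b (-r)) = (n * r : ℕ) :=
    relLength_stdLattice b r (by ring)
  have key := card_mul_le_relLength_of_approx_eigenspace θ (P := stdLattice b 0)
    (N := stdLattice b (-r)) (U := stdLattice b (-((d + K : ℕ) : ℤ)))
    (by rw [hPN]; exact ENat.natCast_ne_top _) (Finset.Ico d (d + K))
    (fun e => -((j + e : ℤ) : ℂ)) (fun e e' h => by simpa using h) T
    (fun e _ => le_inf (fun v hv => Submodule.add_mem _ (hθ v hv)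
      (Submodule.smul_mem _ _ (stdLattice_anti b (by omega) hv))) (stdLattice_anti b (by omega)))
    (fun e he => inf_le_right.trans (stdLattice_anti b (by
      have := (Finset.mem_Ico.1 he).2
      omega)))
    (fun e _ v hv => by
      have := hv.1
      rw [neg_smul, sub_neg_eq_add]
      exact this) (c := (n + 1 : ℕ)) (fun e he => ?_)
  · have hU : relLength (stdLattice b (-r)) (stdLattice b (-((d + K : ℕ) : ℤ))) ≤
        (n * (d + K) : ℕ) :=
      (relLength_anti (stdLattice_anti b (by omega))).trans
        (relLength_stdLattice b (j := -((d + K : ℕ) : ℤ)) (m := 0) (d + K) (by ring)).le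
    have h := key.trans hU
    rw [Nat.card_Ico, Nat.add_sub_cancel_left, ← Nat.cast_mul, Nat.cast_le] at h
    simp only [K] at h
    nlinarith
  · rw [hPN, ← Nat.cast_add, show n * r + (n + 1) = n * (r + 1) + 1 by ring]
    refine hge.trans ?_
    have hde : d ≤ e := (Finset.mem_Ico.1 he).1
    calc _ ≤ relLength ((stdLattice b j).map nabla ⊔ stdLattice b (j + e - (r + 1)))
          (stdLattice b (j - (r + 1))) :=
        relLength_anti (sup_le_sup_left (stdLattice_anti b (by omega)) _)
      _ = _ := (relLength_comap_nabla_eq b hr j e).symm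
      _ ≤ relLength (stdLattice b (j + e)) ((T e).map (singleSMul V (j + e))) :=
        relLength_mono ?_
      _ = relLength ((stdLattice b (j + e)).comap (singleSMul V (j + e))) (T e) :=
        (relLength_comap _ _ _).symm
      _ ≤ _ := relLength_anti fun v hv => by
        have h := single_smul_mem_stdLattice b (m := j + e) 1 hv
        rw [add_zero] at h
        exact h
    rintro w ⟨hw, hwj⟩
    refine ⟨singleSMul V (-(j + e)) w, ⟨?_, ?_⟩, ?_⟩
    · have h1 : (θ + ((j + e : ℤ) : ℂ) • (LinearMap.id : V →ₗ[ℂ] V)) (singleSMul V (-(j + e)) w) =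
          singleSMul V (1 - (j + e)) (nabla w) := by
        simp only [θ, LinearMap.add_apply, LinearMap.comp_apply, LinearMap.smul_apply,
          LinearMap.id_apply, nabla_singleSMul hleib, map_add, map_smul, singleSMul_singleSMul]
        rw [show 1 + (-(j + e) - 1) = -(j + (e : ℤ)) by ring,
          show 1 + -(j + (e : ℤ)) = 1 - (j + e) by ring]
        push_cast
        module
      rw [SetLike.mem_coe, Submodule.mem_comap, h1]
      exact stdLattice_anti b (by omega) (single_smul_mem_stdLattice b 1 hw)
    · exact stdLattice_anti b (by omega) (single_smul_mem_stdLattice b 1 hwj)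
    · rw [singleSMul_singleSMul, add_neg_cancel, singleSMul_apply]
      exact one_smul _ w

include hr in
lemma mem_map_nabla_of_forall_mem_sup {j : ℤ} {y : V}
    (hy : ∀ d : ℕ, y ∈ (stdLattice b j).map nabla ⊔ stdLattice b (j + d - (r + 1))) :
    y ∈ (stdLattice b j).map nabla := by
  let φ : ι × ℤ → Module.Dual ℂ (stdLattice b j) := fun x =>
    coordCoeff b x.1 x.2 ∘ₗ (stdLattice b j).subtype
  let g : ι × ℤ → Module.Dual ℂ (stdLattice b j) := fun x =>
    coordCoeff b x.1 x.2 ∘ₗ nabla ∘ₗ (stdLattice b j).subtype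
  suffices ∃ w, ∀ x, g x w = coordCoeff b x.1 x.2 y by
    obtain ⟨w, hw⟩ := this
    exact ⟨w, w.2, eq_of_forall_coordCoeff_eq b fun i l => hw (i, l)⟩
  refine exists_forall_eq_of_finite (X := Submodule.span ℂ (Set.range φ))
    (fun ξ => ?_) g (fun x => ?_) (fun x => coordCoeff b x.1 x.2 y) (fun s => ?_)
  · obtain ⟨v, hv, h⟩ := exists_coordCoeff_eq b (fun i l => ξ (φ (i, l))) j
    refine ⟨⟨v, hv⟩, fun ψ hψ => ?_⟩
    refine LinearMap.eqOn_span (f := ξ) (g := Module.Dual.eval ℂ _ ⟨v, hv⟩) ?_ hψ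
    rintro _ ⟨⟨i, l⟩, rfl⟩
    change _ = coordCoeff b i l v
    by_cases hl : l < j
    · have h0 : φ (i, l) = 0 := LinearMap.ext fun u => u.2 i l hl
      rw [h0, map_zero, hv i l hl]
    · rw [h i l (not_lt.1 hl)]
  · let s := Finset.Ico j (x.2 + 1 + (r + 1))
    refine Submodule.span_mono ?_ (mem_span_of_iInf_ker_le_ker
      (L := fun z : ι × s => φ (z.1, z.2)) fun v hv => ?_)
    · rintro _ ⟨z, rfl⟩
      exact ⟨_, rfl⟩
    · simp only [Submodule.mem_iInf, LinearMap.mem_ker] at hv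
      have hv' : (v : V) ∈ stdLattice b (x.2 + 1 + (r + 1)) := by
        intro i l hl
        by_cases hj : l < j
        · exact v.2 i l hj
        · exact hv (i, ⟨l, Finset.mem_Ico.2 ⟨not_lt.1 hj, hl⟩⟩)
      exact hr _ _ hv' x.1 x.2 (by omega)
  · let D := s.sup fun x => (x.2 + 1 + (r + 1) - j).toNat
    obtain ⟨_, ⟨v, hv, rfl⟩, z, hz, hvz⟩ := Submodule.mem_sup.1 (hy D)
    refine ⟨⟨v, hv⟩, fun x hx => ?_⟩
    have hD : (x.2 + 1 + (r + 1) - j).toNat ≤ D :=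
      Finset.le_sup (f := fun x : ι × ℤ => (x.2 + 1 + (r + 1) - j).toNat) hx
    rw [← hvz, map_add, hz x.1 x.2 (by omega), add_zero]
    rfl

include hleib hr in
lemma relLength_map_nabla_le (j : ℤ) :
    relLength ((stdLattice b j).map nabla) (stdLattice b (j - (r + 1))) ≤
      (Fintype.card ι * (r + 1) : ℕ) :=
  relLength_le_of_antitone
    (E := fun d : ℕ => (stdLattice b j).map nabla ⊔ stdLattice b (j + d - (r + 1)))
    (fun d d' h => sup_le_sup_left (stdLattice_anti b (by omega)) _)
    (fun d => sup_le (map_nabla_stdLattice_le b hr j) (stdLattice_anti b (by omega)))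
    (fun _ hy => mem_map_nabla_of_forall_mem_sup b hr hy) (ENat.natCast_ne_top _)
    (relLength_map_nabla_sup_le b hleib hr j)

end Connection

section OLattice

variable {V : Type} [AddCommGroup V] [Module ℂ V] [Module (PowerSeries ℂ) V]
  [Module (LaurentSeries ℂ) V]
  [IsScalarTower ℂ (PowerSeries ℂ) V] [IsScalarTower ℂ (LaurentSeries ℂ) V]
  [IsScalarTower (PowerSeries ℂ) (LaurentSeries ℂ) V]
  {ι : Type*} [Fintype ι] (b : Module.Basis ι (LaurentSeries ℂ) V)

lemma coe_powerSeries_smul {W : Type*} [AddCommGroup W] [Module (PowerSeries ℂ) W]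
    [Module (LaurentSeries ℂ) W] [IsScalarTower (PowerSeries ℂ) (LaurentSeries ℂ) W]
    (p : PowerSeries ℂ) (v : W) : (p : LaurentSeries ℂ) • v = p • v :=
  algebraMap_smul (LaurentSeries ℂ) p v

lemma coeff_coe_powerSeries_of_neg (p : PowerSeries ℂ) :
    ∀ l < 0, (p : LaurentSeries ℂ).coeff l = 0 := by
  intro l hl
  rw [PowerSeries.coeff_coe, if_pos hl]

omit [IsScalarTower ℂ (PowerSeries ℂ) V] [Fintype ι] in
lemma powerSeries_smul_mem_stdLattice {j : ℤ} (p : PowerSeries ℂ) {v : V}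
    (hv : v ∈ stdLattice b j) : p • v ∈ stdLattice b j := by
  rw [← coe_powerSeries_smul, ← zero_add j]
  exact smul_mem_stdLattice b (coeff_coe_powerSeries_of_neg p) hv

lemma exists_le_stdLattice_of_fg {M : Submodule (PowerSeries ℂ) V} (hM : M.FG) :
    ∃ j, M.restrictScalars ℂ ≤ stdLattice b j := by
  obtain ⟨s, rfl⟩ := hM
  choose N hN using exists_mem_stdLattice b
  refine ⟨-(s.sup N : ℕ), fun v hv => ?_⟩
  rw [Submodule.restrictScalars_mem] at hv
  induction hv using Submodule.span_induction with
  | mem x hx =>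
    have : N x ≤ s.sup N := Finset.le_sup hx
    exact stdLattice_anti b (by omega) (hN x)
  | zero => exact Submodule.zero_mem _
  | add x y _ _ hx hy => exact Submodule.add_mem _ hx hy
  | smul p x _ hx => exact powerSeries_smul_mem_stdLattice b p hx

omit [Module ℂ V] [IsScalarTower ℂ (PowerSeries ℂ) V] [IsScalarTower ℂ (LaurentSeries ℂ) V] in
lemma exists_smul_mem_of_mem_span {M : Submodule (PowerSeries ℂ) V} {v : V}
    (hv : v ∈ Submodule.span (LaurentSeries ℂ) (M : Set V)) :
    ∃ N : ℕ, ∀ f : LaurentSeries ℂ, (∀ l < (N : ℤ), f.coeff l = 0) → f • v ∈ M := by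
  induction hv using Submodule.span_induction with
  | mem x hx =>
    refine ⟨0, fun f hf => ?_⟩
    obtain ⟨p, rfl⟩ := exists_coe_eq_of_coeff_eq_zero (by simpa using hf)
    rw [coe_powerSeries_smul]
    exact M.smul_mem p hx
  | zero => exact ⟨0, fun f _ => by rw [smul_zero]; exact M.zero_mem⟩
  | add x y _ _ hx hy =>
    obtain ⟨N, hN⟩ := hx
    obtain ⟨N', hN'⟩ := hy
    refine ⟨N + N', fun f hf => ?_⟩
    rw [smul_add]
    exact M.add_mem (hN f fun l hl => hf l (by omega)) (hN' f fun l hl => hf l (by omega))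
  | smul g x _ hx =>
    obtain ⟨N, hN⟩ := hx
    obtain ⟨q, hq⟩ := exists_coeff_eq_zero_of_lt g
    refine ⟨N + q, fun f hf => ?_⟩
    rw [smul_smul]
    exact hN _ fun l hl => coeff_mul_eq_zero_of_lt hf hq l (by omega)

lemma exists_stdLattice_le_of_span_eq_top {M : Submodule (PowerSeries ℂ) V}
    (hM : Submodule.span (LaurentSeries ℂ) (M : Set V) = ⊤) :
    ∃ a, stdLattice b a ≤ M.restrictScalars ℂ := by
  choose N hN using fun i => exists_smul_mem_of_mem_span (M := M) (v := b i) (hM ▸ trivial)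
  refine ⟨(Finset.univ.sup N : ℕ), fun v hv => ?_⟩
  rw [Submodule.restrictScalars_mem, ← b.sum_repr v]
  refine M.sum_mem fun i _ => hN i _ fun l hl => hv i l ?_
  have : N i ≤ Finset.univ.sup N := Finset.le_sup (Finset.mem_univ i)
  omega

omit [Module (PowerSeries ℂ) V] [IsScalarTower ℂ (PowerSeries ℂ) V]
  [IsScalarTower (PowerSeries ℂ) (LaurentSeries ℂ) V] in
lemma exists_le_stdLattice_of_relLength_ne_top {j : ℤ} {L : Submodule ℂ V}
    (hL : relLength (stdLattice b j) L ≠ ⊤) : ∃ j', L ≤ stdLattice b j' := by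
  obtain ⟨a, ha⟩ := exists_forall_le_sup_of_monotone
    (A := fun m : ℕ => L ⊓ stdLattice b (-(m : ℤ)))
    (fun m m' h => inf_le_inf_left L (stdLattice_anti b (by omega))) hL
    (fun m => relLength_mono inf_le_left)
  refine ⟨min j (-a), fun v hv => ?_⟩
  obtain ⟨N, hN⟩ := exists_mem_stdLattice b v
  exact sup_le (stdLattice_anti b (min_le_left _ _))
    (inf_le_right.trans (stdLattice_anti b (min_le_right _ _))) (ha N ⟨hv, hN⟩)

end OLattice

section Main

variable {V : Type*} [AddCommGroup V] [Module ℂ V] [Module (LaurentSeries ℂ) V]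
  [IsScalarTower ℂ (LaurentSeries ℂ) V]
  {ι : Type*} [Fintype ι] (b : Module.Basis ι (LaurentSeries ℂ) V)

lemma relLength_stdLattice_ne_top_of_le {L : Submodule ℂ V} {j j' : ℤ} (hj : j ≤ j')
    (hLj : L ≤ stdLattice b j') (hL : relLength L (stdLattice b j') ≠ ⊤) :
    relLength L (stdLattice b j) ≠ ⊤ := by
  rw [relLength_add hLj (stdLattice_anti b hj),
    relLength_stdLattice b (j' - j).toNat (by omega : j' = j + (j' - j).toNat)]
  exact WithTop.add_ne_top.2 ⟨hL, ENat.natCast_ne_top _⟩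

variable {nabla : V →ₗ[ℂ] V}
  (hleib : ∀ (f : LaurentSeries ℂ) (v : V), nabla (f • v) = dt f • v + f • nabla v)

section

variable {r : ℕ} (hr : ∀ j, ∀ v ∈ stdLattice b j, nabla v ∈ stdLattice b (j - (r + 1)))

include hr in
lemma relLength_comap_nabla_ne_top {L : Submodule ℂ V} {j : ℤ}
    (hLj : L ≤ stdLattice b j) (hL : relLength L (stdLattice b j) ≠ ⊤) :
    relLength (L.comap nabla) (stdLattice b j) ≠ ⊤ := by
  rw [relLength_comap]
  exact ne_top_of_le_ne_top
    (relLength_stdLattice_ne_top_of_le b (by omega : j - (r + 1) ≤ j) hLj hL)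
    (relLength_mono (map_nabla_stdLattice_le b hr j))

include hleib hr in
lemma relLength_stdLattice_le_comap_nabla {L : Submodule ℂ V} {j : ℤ}
    (hLj : L ≤ stdLattice b j) :
    relLength L (stdLattice b j) ≤ relLength (L.comap nabla) (stdLattice b j) := by
  have hp : j - (r + 1) ≤ j := by omega
  have h1 := relLength_add hLj (stdLattice_anti b hp)
  have h2 := relLength_add (P := L) (Q := L ⊔ (stdLattice b j).map nabla) le_sup_left
    (sup_le (hLj.trans (stdLattice_anti b hp)) (map_nabla_stdLattice_le b hr j))
  rw [relLength_stdLattice b (r + 1) (by push_cast; ring)] at h1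
  rw [relLength_sup_right, ← relLength_comap, h1] at h2
  refine (ENat.add_le_add_iff_right (ENat.natCast_ne_top (Fintype.card ι * (r + 1)))).1 ?_
  rw [h2]
  gcongr
  exact (relLength_anti le_sup_right).trans (relLength_map_nabla_le b hleib hr j)

include hleib hr in
lemma relLength_inf_stdLattice_le {L : Submodule ℂ V} {j : ℤ}
    (hLj : L ≤ stdLattice b j) (hL : relLength L (stdLattice b j) ≠ ⊤) :
    relLength L (L.comap nabla ⊓ stdLattice b j) ≤ relLength (L.comap nabla) L := by
  have hA := relLength_comap_nabla_ne_top b hr hLj hL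
  set A := L.comap nabla
  have h1 := relLength_add (P := A ⊓ L) inf_le_right hLj
  have h2 := relLength_add (P := A ⊓ L) (Q := A ⊓ stdLattice b j) (inf_le_inf_left A hLj)
    inf_le_right
  have h3 : A ⊓ L = L ⊓ (A ⊓ stdLattice b j) := by
    rw [inf_left_comm, inf_eq_left.2 hLj]
  rw [relLength_inf_left] at h1
  rw [h1, h3, relLength_inf_left, relLength_inf_left] at h2
  refine (ENat.add_le_add_iff_right hA).1 ?_
  rw [← h2]
  gcongr
  exact relLength_stdLattice_le_comap_nabla b hleib hr hLj

end

include b hleib in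
/-- For a lattice `L`, the relative dimension of `∇⁻¹(L)` with respect to `L` is finite and
nonpositive. -/
lemma relLength_comap_nabla_le {L : Submodule ℂ V} {j : ℤ}
    (hLj : L ≤ stdLattice b j) (hL : relLength L (stdLattice b j) ≠ ⊤) :
    relLength L (L.comap nabla) ≤ relLength (L.comap nabla) L ∧
      relLength (L.comap nabla) L ≠ ⊤ := by
  obtain ⟨r, hr⟩ := exists_nabla_mem_stdLattice b hleib
  have hfin : relLength (L.comap nabla) L ≠ ⊤ :=
    ne_top_of_le_ne_top (relLength_comap_nabla_ne_top b hr hLj hL) (relLength_mono hLj)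
  refine ⟨relLength_le_of_monotone (A := fun m : ℕ => L.comap nabla ⊓ stdLattice b (j - m))
    (fun m m' h => inf_le_inf_left _ (stdLattice_anti b (by omega))) (fun v hv => ?_) hfin
    fun m => ?_, hfin⟩
  · obtain ⟨N, hN⟩ := exists_mem_stdLattice b v
    exact ⟨(N + j).toNat, hv, stdLattice_anti b (by omega) hN⟩
  · have hj : j - m ≤ j := by omega
    exact relLength_inf_stdLattice_le b hleib hr (hLj.trans (stdLattice_anti b hj))
      (relLength_stdLattice_ne_top_of_le b hj hLj hL)

end Main

lemma exists_stdLattice_of_isLatticeIn {V : Type} [AddCommGroup V] [Module ℂ V]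
    [Module (PowerSeries ℂ) V] [Module (LaurentSeries ℂ) V]
    [IsScalarTower ℂ (PowerSeries ℂ) V] [IsScalarTower ℂ (LaurentSeries ℂ) V]
    [IsScalarTower (PowerSeries ℂ) (LaurentSeries ℂ) V]
    {ι : Type*} [Fintype ι] (b : Module.Basis ι (LaurentSeries ℂ) V)
    {L : Submodule ℂ V} (hL : IsLatticeIn L) :
    ∃ j, L ≤ stdLattice b j ∧ relLength L (stdLattice b j) ≠ ⊤ := by
  obtain ⟨M, ⟨hfg, hspan⟩, hfin, hfin'⟩ := hL
  obtain ⟨j, hj⟩ := exists_le_stdLattice_of_fg b hfg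
  obtain ⟨a, ha⟩ := exists_stdLattice_le_of_span_eq_top b hspan
  have h1 : relLength (L ⊓ M.restrictScalars ℂ) L ≠ ⊤ := by
    rw [relLength_eq_length_quotient]
    exact Module.length_ne_top
  have h2 : relLength (L ⊓ M.restrictScalars ℂ) (M.restrictScalars ℂ) ≠ ⊤ := by
    rw [relLength_eq_length_quotient]
    exact Module.length_ne_top
  obtain ⟨j', hj'⟩ := exists_le_stdLattice_of_relLength_ne_top b
    (ne_top_of_le_ne_top h1 (relLength_anti (inf_le_right.trans hj)))
  have hjl : M.restrictScalars ℂ ≤ stdLattice b (min j j') :=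
    hj.trans (stdLattice_anti b (min_le_left _ _))
  refine ⟨min (min j j') a, hj'.trans (stdLattice_anti b (by omega)), ?_⟩
  refine ne_top_of_le_ne_top ?_ (relLength_anti (inf_le_left : L ⊓ M.restrictScalars ℂ ≤ L))
  rw [relLength_add inf_le_right (hjl.trans (stdLattice_anti b (min_le_left _ _)))]
  refine WithTop.add_ne_top.2 ⟨h2, ne_top_of_le_ne_top ?_ (relLength_anti ha)⟩
  rw [relLength_stdLattice b (a - min (min j j') a).toNat (by omega)]
  exact ENat.natCast_ne_top _

lemma rank_quotient_le_of_relLength_le {k W : Type*} [Field k] [AddCommGroup W] [Module k W]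
    {P Q : Submodule k W} (h : relLength Q P ≤ relLength P Q) (hfin : relLength P Q ≠ ⊤) :
    Module.rank k (P ⧸ (P ⊓ Q).comap P.subtype) ≤
      Module.rank k (Q ⧸ (P ⊓ Q).comap Q.subtype) := by
  rw [← relLength_inf_left P Q] at h hfin
  rw [← relLength_inf_left Q P, inf_comm Q P, relLength_eq_length_quotient,
    relLength_eq_length_quotient, Module.length_eq_rank, Module.length_eq_rank] at h
  rw [relLength_eq_length_quotient, Module.length_eq_rank, Ne, Cardinal.toENat_eq_top,
    not_le] at hfin
  exact (Cardinal.toENat_le_iff_of_lt_aleph0 hfin).1 h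

/-- For a connection `∇` on a finite-dimensional `ℂ((t))`-vector space `V` and a lattice
`L ⊂ V`, the relative dimension `[∇⁻¹(L) : L]` is nonpositive:
`dim_ℂ(∇⁻¹(L)/(∇⁻¹(L) ∩ L)) ≤ dim_ℂ(L/(∇⁻¹(L) ∩ L))`. -/
theorem relative_dimension_of_preimage_nonpositive
    (V : Type) [AddCommGroup V] [Module ℂ V] [Module (PowerSeries ℂ) V]
    [Module (LaurentSeries ℂ) V]
    [IsScalarTower ℂ (PowerSeries ℂ) V] [IsScalarTower ℂ (LaurentSeries ℂ) V]
    [IsScalarTower (PowerSeries ℂ) (LaurentSeries ℂ) V]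
    [FiniteDimensional (LaurentSeries ℂ) V]
    (nabla : V →ₗ[ℂ] V)
    (hleib : ∀ (f : LaurentSeries ℂ) (v : V), nabla (f • v) = dt f • v + f • nabla v)
    (L : Submodule ℂ V) (hL : IsLatticeIn L) :
    Module.rank ℂ
        (↥(L.comap nabla) ⧸ Submodule.comap (L.comap nabla).subtype (L.comap nabla ⊓ L)) ≤
      Module.rank ℂ (↥L ⧸ Submodule.comap L.subtype (L.comap nabla ⊓ L)) := by
  let b := Module.finBasis (LaurentSeries ℂ) V
  obtain ⟨j, hLj, hfin⟩ := exists_stdLattice_of_isLatticeIn b hL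
  obtain ⟨h, h_ne_top⟩ := relLength_comap_nabla_le b hleib hLj hfin
  exact rank_quotient_le_of_relLength_le h h_ne_top
end
end

section
/- Let V be an n-dimensional vector space over F = ℂ((t)) with a connection ∇. Then the solution space Sol = ker ∇ = {v ∈ V : ∇v = 0} is a ℂ-subspace of V of dimension at most n. -/
open HahnSeries Matrix

noncomputable section

/-- A Laurent series with vanishing derivative is constant. -/
theorem eq_smul_one_of_dt_eq_zero {f : LaurentSeries ℂ} (hf : dt f = 0) :
    f = f.coeff 0 • (1 : LaurentSeries ℂ) := by
  ext k
  rcases eq_or_ne k 0 with rfl | hk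
  · simp
  · have h : (dt f).coeff (k - 1) = 0 := by rw [hf, HahnSeries.coeff_zero]
    have h' : (k : ℂ) * f.coeff k = 0 := by simpa [dt] using h
    simpa [HahnSeries.coeff_one, hk] using h'

/-- Horizontal vectors of a connection that are linearly independent over `ℂ` are linearly
independent over `ℂ((t))`. -/
theorem linearIndependent_of_horizontal {V ι : Type*} [AddCommGroup V] [Module ℂ V]
    [Module (LaurentSeries ℂ) V] [IsScalarTower ℂ (LaurentSeries ℂ) V] (nabla : V →ₗ[ℂ] V)
    (hleib : ∀ (f : LaurentSeries ℂ) (v : V), nabla (f • v) = dt f • v + f • nabla v)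
    {v : ι → V} (hv : ∀ i, nabla (v i) = 0) (hli : LinearIndependent ℂ v) :
    LinearIndependent (LaurentSeries ℂ) v := by
  classical
  rw [linearIndependent_iff']
  intro s
  induction s using Finset.induction_on with
  | empty => simp
  | insert a s ha ih =>
    intro g hg
    have hga : g a = 0 := by
      by_contra hne
      have hsum : v a + ∑ i ∈ s, ((g a)⁻¹ * g i) • v i = 0 := by
        have := congrArg ((g a)⁻¹ • ·) hg
        simpa [Finset.sum_insert ha, smul_add, Finset.smul_sum, smul_smul, hne] using this
      have hder : ∑ i ∈ s, dt ((g a)⁻¹ * g i) • v i = 0 := by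
        have := congrArg nabla hsum
        simpa [hleib, hv] using this
      have hconst : ∀ i ∈ s,
          ((g a)⁻¹ * g i) • v i = ((g a)⁻¹ * g i).coeff 0 • v i := fun i hi => by
        conv_lhs => rw [eq_smul_one_of_dt_eq_zero (ih _ hder i hi), smul_assoc, one_smul]
      rw [Finset.sum_congr rfl hconst] at hsum
      have hrel : ∑ i ∈ insert a s,
          (if i = a then 1 else ((g a)⁻¹ * g i).coeff 0) • v i = 0 := by
        rw [Finset.sum_insert ha, if_pos rfl, one_smul, ← hsum]
        congr 1
        exact Finset.sum_congr rfl fun i hi => by rw [if_neg (ne_of_mem_of_not_mem hi ha)]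
      have := linearIndependent_iff'.mp hli _ _ hrel a (Finset.mem_insert_self a s)
      simp at this
    have hga' : g a • v a = 0 := hga ▸ zero_smul (LaurentSeries ℂ) (v a)
    have hg' : ∑ i ∈ s, g i • v i = 0 := by simpa [Finset.sum_insert ha, hga'] using hg
    intro i hi
    rcases Finset.mem_insert.mp hi with rfl | hi
    · exact hga
    · exact ih g hg' i hi

/-- The solution space `Sol = ker ∇` of a connection on an `n`-dimensional vector space over
`ℂ((t))` has `ℂ`-dimension at most `n`. -/
theorem solution_space_dim_le (n : ℕ)
    (V : Type) [AddCommGroup V] [Module ℂ V] [Module (LaurentSeries ℂ) V]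
    [IsScalarTower ℂ (LaurentSeries ℂ) V] [FiniteDimensional (LaurentSeries ℂ) V]
    (hdim : Module.finrank (LaurentSeries ℂ) V = n)
    (nabla : V →ₗ[ℂ] V)
    (hleib : ∀ (f : LaurentSeries ℂ) (v : V), nabla (f • v) = dt f • v + f • nabla v) :
    Module.rank ℂ ↥(LinearMap.ker nabla) ≤ (n : Cardinal) := by
  refine rank_le fun s hs => ?_
  have hli : LinearIndependent ℂ fun i : s => ((i : LinearMap.ker nabla) : V) :=
    hs.map' (LinearMap.ker nabla).subtype (Submodule.ker_subtype _)
  have hF := linearIndependent_of_horizontal nabla hleib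
    (fun i : s => LinearMap.mem_ker.mp i.1.2) hli
  simpa [hdim] using hF.fintype_card_le_finrank
end
end

section
/- Let n ≥ 2 and consider in Mₙ(ℂ) the regular nilpotent matrix f = Σ_{i=1}^{n−1} E_{i+1,i} and the matrix e = Σ_{i=1}^{n−1} i(n−i) E_{i,i+1}, which together with h = 2ρ̌ = diag(n−1, n−3, …, −(n−1)) form a principal sl₂-triple. Then Mₙ(ℂ) = 𝔤ᵉ + ad(f)(Mₙ(ℂ)): every X ∈ Mₙ(ℂ) can be written X = Z + (fY − Yf) with Z ∈ Mₙ(ℂ) satisfying eZ = Ze and Y ∈ Mₙ(ℂ). -/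
open Matrix

noncomputable section

/-- The regular nilpotent lower Jordan block `f = Σ_{i=1}^{n-1} E_{i+1,i}`. -/
def fmat (n : ℕ) : Matrix (Fin n) (Fin n) ℂ :=
  Matrix.of fun i j => if (i : ℕ) = (j : ℕ) + 1 then 1 else 0

/-- The matrix `e = Σ_{i=1}^{n-1} i(n-i) E_{i,i+1}`, which together with
`h = diag(n-1, n-3, …, -(n-1))` and `f` forms a principal `sl₂`-triple. -/
def emat (n : ℕ) : Matrix (Fin n) (Fin n) ℂ :=
  Matrix.of fun i j =>
    if (j : ℕ) = (i : ℕ) + 1 then ((((i : ℕ) + 1) * (n - ((i : ℕ) + 1)) : ℕ) : ℂ) else 0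

/-- The linear map `Y ↦ F * Y - Y * F` on square matrices. -/
def adMatrix {m : Type*} [Fintype m] (F : Matrix m m ℂ) : Matrix m m ℂ →ₗ[ℂ] Matrix m m ℂ :=
  LinearMap.mulLeft ℂ F - LinearMap.mulRight ℂ F

theorem adMatrix_apply {m : Type*} [Fintype m] (F Y : Matrix m m ℂ) :
    adMatrix F Y = F * Y - Y * F := rfl

open scoped ComplexOrder in
theorem ker_adMatrix_conjTranspose_comp {m : Type*} [Fintype m] (F : Matrix m m ℂ) :
    LinearMap.ker (adMatrix Fᴴ ∘ₗ adMatrix F) = LinearMap.ker (adMatrix F) := by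
  refine le_antisymm (fun Y hY => ?_) (LinearMap.ker_le_ker_comp _ _)
  rw [LinearMap.mem_ker, LinearMap.comp_apply] at hY
  rw [LinearMap.mem_ker, ← Matrix.trace_conjTranspose_mul_self_eq_zero_iff]
  set Z := adMatrix F Y with hZ
  have key : (Zᴴ * Z).trace = (Yᴴ * adMatrix Fᴴ Z).trace := by
    have hZ' : Zᴴ = Yᴴ * Fᴴ - Fᴴ * Yᴴ := by
      simp [hZ, adMatrix_apply, Matrix.conjTranspose_sub, Matrix.conjTranspose_mul]
    rw [hZ', adMatrix_apply, Matrix.sub_mul, Matrix.mul_sub, Matrix.trace_sub, Matrix.trace_sub,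
      Matrix.mul_assoc, Matrix.trace_mul_cycle Fᴴ Yᴴ Z, Matrix.trace_mul_comm (Z * Fᴴ) Yᴴ]
  rw [key, hY, Matrix.mul_zero, Matrix.trace_zero]

theorem finrank_range_adMatrix_conjTranspose_comp {m : Type*} [Fintype m] (F : Matrix m m ℂ) :
    Module.finrank ℂ (LinearMap.range (adMatrix Fᴴ ∘ₗ adMatrix F)) =
      Module.finrank ℂ (LinearMap.range (adMatrix F)) := by
  have h₁ := LinearMap.finrank_range_add_finrank_ker (adMatrix Fᴴ ∘ₗ adMatrix F)
  have h₂ := LinearMap.finrank_range_add_finrank_ker (adMatrix F)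
  rw [ker_adMatrix_conjTranspose_comp] at h₁
  omega

theorem finrank_range_adMatrix_le {m : Type*} [Fintype m] (F : Matrix m m ℂ) :
    Module.finrank ℂ (LinearMap.range (adMatrix F)) ≤
      Module.finrank ℂ (LinearMap.range (adMatrix Fᴴ)) := by
  rw [← finrank_range_adMatrix_conjTranspose_comp]
  exact Submodule.finrank_mono (LinearMap.range_comp_le_range _ _)

/-- Every square matrix is the sum of a matrix commuting with `Fᴴ` and a commutator with `F`. -/
theorem exists_commute_conjTranspose_add_commutator {m : Type*} [Fintype m]
    (F X : Matrix m m ℂ) :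
    ∃ Z Y : Matrix m m ℂ, Fᴴ * Z = Z * Fᴴ ∧ X = Z + (F * Y - Y * F) := by
  have hrange : LinearMap.range (adMatrix Fᴴ ∘ₗ adMatrix F) = LinearMap.range (adMatrix Fᴴ) := by
    refine Submodule.eq_of_le_of_finrank_le (LinearMap.range_comp_le_range _ _) ?_
    rw [finrank_range_adMatrix_conjTranspose_comp]
    have h := finrank_range_adMatrix_le Fᴴ
    rwa [Matrix.conjTranspose_conjTranspose] at h
  obtain ⟨Y, hY⟩ : adMatrix Fᴴ X ∈ LinearMap.range (adMatrix Fᴴ ∘ₗ adMatrix F) :=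
    hrange ▸ LinearMap.mem_range_self _ X
  refine ⟨X - adMatrix F Y, Y, ?_, by rw [adMatrix_apply]; abel⟩
  rw [← sub_eq_zero, ← adMatrix_apply, map_sub, sub_eq_zero]
  exact hY.symm

/-- The decomposition with respect to `f` and any `e` that becomes the conjugate transpose of `f`
after a simultaneous change of basis. -/
theorem exists_commute_add_commutator_of_conj {m : Type*} [Fintype m] [DecidableEq m]
    {D D' e f : Matrix m m ℂ} (hD : D' * D = 1) (he : (D * f * D')ᴴ = D * e * D')
    (X : Matrix m m ℂ) :
    ∃ Z Y : Matrix m m ℂ, e * Z = Z * e ∧ X = Z + (f * Y - Y * f) := by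
  have hl (A : Matrix m m ℂ) : D' * (D * A) = A := by rw [← Matrix.mul_assoc, hD, Matrix.one_mul]
  obtain ⟨Z, Y, hZ, hX⟩ := exists_commute_conjTranspose_add_commutator (D * f * D') (D * X * D')
  rw [he] at hZ
  refine ⟨D' * Z * D, D' * Y * D, ?_, ?_⟩
  · have h := congrArg (fun A => D' * A * D) hZ
    simpa only [Matrix.mul_assoc, hl, hD, Matrix.mul_one] using h
  · have h := congrArg (fun A => D' * A * D) hX
    simpa only [Matrix.mul_assoc, hl, hD, Matrix.mul_one, Matrix.mul_add, Matrix.add_mul,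
      Matrix.mul_sub, Matrix.sub_mul] using h

/-- The diagonal entries of the change of basis under which `emat n` becomes the conjugate
transpose of `fmat n`. -/
def scaling (n i : ℕ) : ℝ :=
  ∏ k ∈ Finset.range i, √(((k + 1) * (n - (k + 1)) : ℕ) : ℝ)

theorem scaling_pos {n i : ℕ} (hi : i < n) : 0 < scaling n i := by
  refine Finset.prod_pos fun k hk => Real.sqrt_pos.2 (Nat.cast_pos.2 ?_)
  have := Finset.mem_range.1 hk
  exact Nat.mul_pos (by omega) (by omega)

theorem scaling_succ_sq (n i : ℕ) :
    scaling n (i + 1) ^ 2 = scaling n i ^ 2 * (((i + 1) * (n - (i + 1)) : ℕ) : ℝ) := by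
  rw [scaling, Finset.prod_range_succ, mul_pow, Real.sq_sqrt (Nat.cast_nonneg _), scaling]

theorem conjTranspose_conj_fmat (n : ℕ) :
    (Matrix.diagonal (fun i : Fin n => (scaling n i : ℂ)) * fmat n *
        Matrix.diagonal (fun i : Fin n => (scaling n i : ℂ)⁻¹))ᴴ =
      Matrix.diagonal (fun i : Fin n => (scaling n i : ℂ)) * emat n *
        Matrix.diagonal (fun i : Fin n => (scaling n i : ℂ)⁻¹) := by
  ext i j
  rw [Matrix.conjTranspose_apply]
  simp only [Matrix.mul_diagonal, Matrix.diagonal_mul, fmat, emat, Matrix.of_apply]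
  have hi : (scaling n i : ℂ) ≠ 0 := Complex.ofReal_ne_zero.2 (scaling_pos i.2).ne'
  have hj : (scaling n j : ℂ) ≠ 0 := Complex.ofReal_ne_zero.2 (scaling_pos j.2).ne'
  split_ifs with h
  · have hs : (scaling n j : ℂ) ^ 2 =
        (scaling n i : ℂ) ^ 2 * ((((i : ℕ) + 1) * (n - ((i : ℕ) + 1)) : ℕ) : ℂ) := by
      rw [h]
      exact_mod_cast scaling_succ_sq n i
    simp only [mul_one, star_mul', star_inv₀, Complex.star_def, Complex.conj_ofReal]
    field_simp
    exact hs
  · simp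

/-- `Mₙ(ℂ) = 𝔤ᵉ + ad(f)(Mₙ(ℂ))`: every `X ∈ Mₙ(ℂ)` can be written as `X = Z + [f, Y]` with
`Z` in the centralizer of `e`. -/
theorem centralizer_add_ad_f_eq_top (n : ℕ) (hn : 2 ≤ n) (X : Matrix (Fin n) (Fin n) ℂ) :
    ∃ Z Y : Matrix (Fin n) (Fin n) ℂ,
      emat n * Z = Z * emat n ∧ X = Z + (fmat n * Y - Y * fmat n) := by
  have hD : Matrix.diagonal (fun i : Fin n => (scaling n i : ℂ)⁻¹) *
      Matrix.diagonal (fun i : Fin n => (scaling n i : ℂ)) = 1 := by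
    rw [Matrix.diagonal_mul_diagonal, ← Matrix.diagonal_one]
    congr 1
    funext i
    exact inv_mul_cancel₀ (Complex.ofReal_ne_zero.2 (scaling_pos i.2).ne')
  exact exists_commute_add_commutator_of_conj hD (conjTranspose_conj_fmat n) X
end
end

section
/- Let n ≥ 1 and let ∇ be the connection on V = Fⁿ (F = ℂ((t))) given by ∇(v) = ∂_t v + (H₁ t^{r₁} + H₂ t^{r₂} + ⋯ + H_m t^{r_m} + X t^{−1}) v, where r₁ < r₂ < ⋯ < r_m < −1 are integers, H₁, …, H_m are diagonal matrices in Mₙ(ℂ), X ∈ Mₙ(ℂ) is upper triangular, and Hᵢ X = X Hᵢ for all i (a connection in canonical form). Let Λ = Oⁿ ⊂ V. Then for every integer k, ∇⁻¹(tᵏ Λ) ⊆ t^{k+1} Λ + Sol, where Sol = ker ∇ = {v ∈ V : ∇v = 0}. -/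
open HahnSeries Matrix

noncomputable section

/-- The connection `∇(v) = ∂ₜv + (Σᵢ Hᵢ t^{rᵢ} + X t⁻¹) v` on `Fⁿ` attached to the data of a
canonical form. -/
def conn (n m : ℕ) (rs : Fin m → ℤ) (H : Fin m → Matrix (Fin n) (Fin n) ℂ)
    (X : Matrix (Fin n) (Fin n) ℂ) (v : Fin n → LaurentSeries ℂ) : Fin n → LaurentSeries ℂ :=
  (fun i => dt (v i)) +
    ((∑ i : Fin m, (HahnSeries.single (rs i) (1 : ℂ) : LaurentSeries ℂ) •
        (H i).map (algebraMap ℂ (LaurentSeries ℂ))) +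
      (HahnSeries.single (-1 : ℤ) (1 : ℂ) : LaurentSeries ℂ) •
        X.map (algebraMap ℂ (LaurentSeries ℂ))).mulVec v

theorem conn_coeff {n m : ℕ} {rs : Fin m → ℤ} {H : Fin m → Matrix (Fin n) (Fin n) ℂ}
    (hH : ∀ i, (H i).IsDiag) (X : Matrix (Fin n) (Fin n) ℂ) (v : Fin n → LaurentSeries ℂ)
    (a : Fin n) (l : ℤ) :
    ((conn n m rs H X v) a).coeff l = (l + 1 : ℤ) * (v a).coeff (l + 1) +
      ∑ i, H i a a * (v a).coeff (l - rs i) + ∑ b, X a b * (v b).coeff (l + 1) := by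
  have hmonomial (r : ℤ) (c : ℂ) (f : LaurentSeries ℂ) :
      ((HahnSeries.single r (1 : ℂ) : LaurentSeries ℂ) *
        (algebraMap ℂ (LaurentSeries ℂ) c * f)).coeff l = c * f.coeff (l - r) := by
    rw [LaurentSeries.algebraMap_apply, HahnSeries.coeff_single_mul, one_mul,
      HahnSeries.C_mul_eq_smul, HahnSeries.coeff_smul, smul_eq_mul]
  have hdiag (i : Fin m) :
      ∑ b, H i a b * (v b).coeff (l - rs i) = H i a a * (v a).coeff (l - rs i) :=
    Finset.sum_eq_single a (fun b _ hb => by rw [hH i hb.symm, zero_mul]) (by simp)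
  have hmulVec (r : ℤ) (A : Matrix (Fin n) (Fin n) ℂ) :
      ((((HahnSeries.single r (1 : ℂ) : LaurentSeries ℂ) •
        A.map (algebraMap ℂ (LaurentSeries ℂ))).mulVec v) a).coeff l =
        ∑ b, A a b * (v b).coeff (l - r) := by
    rw [Matrix.smul_mulVec, Pi.smul_apply, smul_eq_mul, Matrix.mulVec, dotProduct,
      Finset.mul_sum, HahnSeries.coeff_sum]
    exact Finset.sum_congr rfl fun b _ => hmonomial r (A a b) (v b)
  rw [conn, Matrix.add_mulVec, Matrix.sum_mulVec, Pi.add_apply, Pi.add_apply, Finset.sum_apply,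
    HahnSeries.coeff_add, HahnSeries.coeff_add, HahnSeries.coeff_sum, hmulVec, sub_neg_eq_add,
    ← add_assoc]
  simp only [hmulVec, hdiag]
  rfl

theorem diag_apply_eq_of_commute {n : ℕ} {D X : Matrix (Fin n) (Fin n) ℂ} (hD : D.IsDiag)
    (h : D * X = X * D) {a b : Fin n} (hab : X a b ≠ 0) : D a a = D b b := by
  have h' := congrFun (congrFun h a) b
  rw [← hD.diagonal_diag, Matrix.diagonal_mul, Matrix.mul_diagonal, mul_comm] at h'
  exact mul_left_cancel₀ hab h'

theorem exists_coeff_eq_zero_of_lt_s14 {n : ℕ} (v : Fin n → LaurentSeries ℂ) :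
    ∃ N : ℤ, ∀ a, ∀ l < N, (v a).coeff l = 0 := by
  obtain ⟨N, hN⟩ := (Set.finite_range fun a => (v a).order).bddBelow
  exact ⟨N, fun a l hl => HahnSeries.coeff_eq_zero_of_lt_order (hl.trans_le (hN ⟨a, rfl⟩))⟩

/-- In a row whose irregular part does not vanish, `∇v ∈ tᵏΛ` forces `v ∈ t^{k+1}Λ`. -/
theorem coeff_eq_zero_of_irregular {n m : ℕ} {rs : Fin m → ℤ} (hmono : StrictMono rs)
    (hrs : ∀ i, rs i < -1) {H : Fin m → Matrix (Fin n) (Fin n) ℂ} (hH : ∀ i, (H i).IsDiag)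
    {X : Matrix (Fin n) (Fin n) ℂ} (hcomm : ∀ i, H i * X = X * H i) {k : ℤ}
    {v : Fin n → LaurentSeries ℂ}
    (hv : ∀ i : Fin n, ∀ l : ℤ, l < k → ((conn n m rs H X v) i).coeff l = 0)
    (a : Fin n) (ha : ∃ i, H i a a ≠ 0) (l : ℤ) (hl : l < k + 1) : (v a).coeff l = 0 := by
  obtain ⟨N, hN⟩ := exists_coeff_eq_zero_of_lt_s14 v
  have key (d : ℕ) : ∀ a, (∃ i, H i a a ≠ 0) → ∀ l < k + 1, l < N + d →
      (v a).coeff l = 0 := by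
    induction d with
    | zero => exact fun a _ l _ h => hN a l (by simpa using h)
    | succ d ih =>
      intro a ha l hlk hld
      push_cast at hld
      obtain ⟨i, hi, hmin⟩ := WellFounded.has_min (wellFounded_lt (α := Fin m))
        {i | H i a a ≠ 0} ha
      have hri := hrs i
      have h := hv a (l + rs i) (by omega)
      rw [conn_coeff hH, ih a ha (l + rs i + 1) (by omega) (by omega), mul_zero, zero_add,
        Finset.sum_eq_single i, Finset.sum_eq_zero, add_zero, add_sub_cancel_right] at h
      · exact (mul_eq_zero.mp h).resolve_left hi
      · intro b _
        by_cases hab : X a b = 0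
        · rw [hab, zero_mul]
        · rw [ih b ⟨i, diag_apply_eq_of_commute (hH i) (hcomm i) hab ▸ hi⟩ _
            (by omega) (by omega), mul_zero]
      · intro j _ hj
        by_cases hja : H j a a = 0
        · rw [hja, zero_mul]
        · have hlt : rs i < rs j := hmono (lt_of_le_of_ne (not_lt.mp (hmin j hja)) hj.symm)
          rw [ih a ha _ (by omega) (by omega), mul_zero]
      · simp
  exact key (l - N + 1).toNat a ha l hl (by omega)

/-- For a connection in canonical form `∇ = ∂ₜ + Σᵢ Hᵢ t^{rᵢ} + X t⁻¹` (with
`r₁ < ⋯ < r_m < -1`, `Hᵢ` diagonal, `X` upper triangular, `[Hᵢ, X] = 0`) and the standard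
lattice `Λ = Oⁿ`, one has `∇⁻¹(tᵏΛ) ⊆ t^{k+1}Λ + Sol` for every `k`, where `Sol = ker ∇`. -/
theorem canonical_form_preimage_subset (n : ℕ) (hn : 1 ≤ n) (m : ℕ)
    (rs : Fin m → ℤ) (hmono : StrictMono rs) (hrs : ∀ i, rs i < -1)
    (H : Fin m → Matrix (Fin n) (Fin n) ℂ) (hH : ∀ i, (H i).IsDiag)
    (X : Matrix (Fin n) (Fin n) ℂ) (hX : ∀ a b : Fin n, b < a → X a b = 0)
    (hcomm : ∀ i, H i * X = X * H i)
    (k : ℤ) (v : Fin n → LaurentSeries ℂ)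
    (hv : ∀ i : Fin n, ∀ l : ℤ, l < k → ((conn n m rs H X v) i).coeff l = 0) :
    ∃ w s : Fin n → LaurentSeries ℂ, v = w + s ∧
      (∀ i : Fin n, ∀ l : ℤ, l < k + 1 → (w i).coeff l = 0) ∧
      conn n m rs H X s = 0 := by
  classical
  let s : Fin n → LaurentSeries ℂ := fun a =>
    if ∃ i, H i a a ≠ 0 then 0 else HahnSeries.truncLT (k + 1) (v a)
  have hs (a : Fin n) (l : ℤ) : (s a).coeff l = if l < k + 1 then (v a).coeff l else 0 := by
    by_cases ha : ∃ i, H i a a ≠ 0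
    · simp only [s, if_pos ha, HahnSeries.coeff_zero]
      split_ifs with hl
      · exact (coeff_eq_zero_of_irregular hmono hrs hH hcomm hv a ha l hl).symm
      · rfl
    · simp only [s, if_neg ha, HahnSeries.coeff_truncLT]
  refine ⟨v - s, s, (sub_add_cancel v s).symm, fun a l hl => ?_, ?_⟩
  · rw [Pi.sub_apply, HahnSeries.coeff_sub, hs, if_pos hl, sub_self]
  · funext a
    ext l
    rw [conn_coeff hH, Pi.zero_apply, HahnSeries.coeff_zero]
    have hH0 (u : Fin n → LaurentSeries ℂ) (ha : ¬∃ i, H i a a ≠ 0) :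
        ∑ i, H i a a * (u a).coeff (l - rs i) = 0 :=
      Finset.sum_eq_zero fun i _ => by rw [not_not.mp (not_exists.mp ha i), zero_mul]
    by_cases ha : ∃ i, H i a a ≠ 0
    · obtain ⟨i, hi⟩ := ha
      have hsa (b : Fin n) (hb : H i b b ≠ 0) : s b = 0 := if_pos ⟨i, hb⟩
      rw [hsa a hi, Finset.sum_eq_zero (s := Finset.univ) (f := fun b => X a b * _)]
      · simp
      · intro b _
        by_cases hab : X a b = 0
        · rw [hab, zero_mul]
        · rw [hsa b (diag_apply_eq_of_commute (hH i) (hcomm i) hab ▸ hi), HahnSeries.coeff_zero,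
            mul_zero]
    · rw [hH0 s ha]
      simp only [hs]
      by_cases hl : l < k
      · have h := hv a l hl
        rw [conn_coeff hH, hH0 v ha] at h
        simpa [hl] using h
      · simp [hl]
end
end
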